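/- arXiv:0906.3056 — 7 statements merged into one kernel-verified Lean document; each statement's English description precedes it below -/
import Mathlib

section
/- Let k ≥ 1 and M ≥ 1 be natural numbers and t : Fin M → ℝ. Define the constraint matrix A with rows indexed by Fin k ⊕ (Fin k ⊕ Fin M) and columns indexed by Fin k × Fin M as follows: the row indexed by the first copy of i ∈ Fin k has entry t_j in column (i, j) and 0 in all columns (i', j) with i' ≠ i; the row indexed by the second copy of i ∈ Fin k has entry 1 in column (i, j) for every j and 0 elsewhere; the row indexed by j ∈ Fin M has entry 1 in column (i, j) for every i and 0 elsewhere. Then the rank of A (over ℝ) is at most M + 2k − 1. -/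
/-- The constraint matrix of the SMCC linear programming relaxation has rank
at most `M + 2k - 1`. Rows are indexed by `Fin k ⊕ (Fin k ⊕ Fin M)`: the first
copy of `Fin k` gives the load constraint rows (entry `t j` in column `(i, j)`),
the second copy of `Fin k` gives the capacity constraint rows (entry `1` in
column `(i, j)`), and `Fin M` gives the assignment constraint rows (entry `1`
in column `(i, j)` for every `i`). -/
theorem smcc_constraint_matrix_rank_le
    (k M : ℕ) (hk : 1 ≤ k) (hM : 1 ≤ M) (t : Fin M → ℝ)
    (A : Matrix (Fin k ⊕ (Fin k ⊕ Fin M)) (Fin k × Fin M) ℝ)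
    (hA : ∀ r p, A r p =
      Sum.elim
        (fun i : Fin k => if p.1 = i then t p.2 else 0)
        (Sum.elim
          (fun i : Fin k => if p.1 = i then (1 : ℝ) else 0)
          (fun j : Fin M => if p.2 = j then (1 : ℝ) else 0)) r) :
    A.rank ≤ M + 2 * k - 1 := by
  have h1 := A.rank_le_card_height
  have hcard : Fintype.card (Fin k ⊕ (Fin k ⊕ Fin M)) = k + (k + M) := by simp
  by_contra hlt
  have heq : A.rank = k + (k + M) := by omega
  have hLI : LinearIndependent ℝ A.row := by
    rw [linearIndependent_iff_card_eq_finrank_span, hcard, Set.finrank,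
      ← Matrix.rank_eq_finrank_span_row, heq]
  rw [Fintype.linearIndependent_iff] at hLI
  -- the capacity rows and the assignment rows have the same sum
  have h0 := hLI (Sum.elim (fun _ => 0) (Sum.elim (fun _ => 1) (fun _ => -1))) (by
    ext p
    simp [Fintype.sum_sum_type, Matrix.row, hA]) (Sum.inr (Sum.inl ⟨0, hk⟩))
  simp at h0
end

section
/- Let k ≥ 1 machines have positive integer capacities m_1, …, m_k, and let M ≥ 1 jobs have nonnegative real processing times t_1, …, t_M, with M ≤ ∑_i m_i. Let b : Fin k → ℝ and let S ⊆ (Fin k → Fin M → ℝ) be the set of all x satisfying: x i j ≥ 0 for all i, j; ∑_i x i j = 1 for every job j; ∑_j x i j ≤ m_i for every machine i; and ∑_j (x i j) * t_j ≤ b_i for every machine i. If x is an extreme point of S (over ℝ), then the number of pairs (i, j) with x i j ≠ 0 is at most M + 2k − 1. -/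
/-- A basic (extreme point) solution of the BLPR feasible set (with empty
partial assignment `F = ∅`) has at most `M + 2k - 1` nonzero variables. -/
theorem smcc_basic_solution_support_le
    (k M : ℕ) (hk : 1 ≤ k) (hM : 1 ≤ M)
    (m : Fin k → ℕ) (hm : ∀ i, 0 < m i)
    (t : Fin M → ℝ) (ht : ∀ j, 0 ≤ t j)
    (hMm : M ≤ ∑ i, m i)
    (b : Fin k → ℝ)
    (S : Set (Fin k → Fin M → ℝ))
    (hS : S = {x | (∀ i j, 0 ≤ x i j) ∧ (∀ j, ∑ i, x i j = 1) ∧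
        (∀ i, ∑ j, x i j ≤ (m i : ℝ)) ∧ (∀ i, ∑ j, x i j * t j ≤ b i)})
    (x : Fin k → Fin M → ℝ) (hx : x ∈ Set.extremePoints ℝ S) :
    {p : Fin k × Fin M | x p.1 p.2 ≠ 0}.ncard ≤ M + 2 * k - 1 := by
  by_contra hcard
  push Not at hcard
  have hxS := hx.1
  rw [hS] at hxS
  obtain ⟨h0, h1, h2, h3⟩ := hxS
  let i0 : Fin k := ⟨0, hk⟩
  let L : (Fin k → Fin M → ℝ) →ₗ[ℝ] ((Fin M → ℝ) × ({i : Fin k // i ≠ i0} → ℝ) ×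
      (Fin k → ℝ) × ({p : Fin k × Fin M // x p.1 p.2 = 0} → ℝ)) :=
    { toFun := fun y => (fun j => ∑ i, y i j, fun i => ∑ j, y i.1 j,
        fun i => ∑ j, y i j * t j, fun p => y p.1.1 p.1.2)
      map_add' := by
        intro y z
        ext <;> simp [Finset.sum_add_distrib, add_mul]
      map_smul' := by
        intro c y
        ext <;> simp [Finset.mul_sum, mul_assoc] }
  have hc : {p : Fin k × Fin M | x p.1 p.2 ≠ 0}.ncard
      + Fintype.card {p : Fin k × Fin M // x p.1 p.2 = 0} = k * M := by
    have h := Set.ncard_add_ncard_compl {p : Fin k × Fin M | x p.1 p.2 ≠ 0}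
    have e : {p : Fin k × Fin M | x p.1 p.2 ≠ 0}ᶜ = {p : Fin k × Fin M | x p.1 p.2 = 0} := by
      ext p; simp
    rw [e, ← Nat.card_coe_set_eq {p : Fin k × Fin M | x p.1 p.2 = 0}] at h
    rw [← Nat.card_eq_fintype_card]
    rw [Nat.card_prod, Nat.card_fin, Nat.card_fin] at h
    exact h
  have hker : LinearMap.ker L ≠ ⊥ := by
    apply LinearMap.ker_ne_bot_of_finrank_lt
    have hd : Module.finrank ℝ (Fin k → Fin M → ℝ) = k * M := by
      rw [Module.finrank_pi_fintype]; simp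
    have hi : Fintype.card {i : Fin k // i ≠ i0} = k - 1 := by
      rw [Fintype.card_subtype_compl]; simp
    rw [hd, Module.finrank_prod, Module.finrank_prod, Module.finrank_prod,
      Module.finrank_fintype_fun_eq_card, Module.finrank_fintype_fun_eq_card,
      Module.finrank_fintype_fun_eq_card, Module.finrank_fintype_fun_eq_card, hi,
      Fintype.card_fin, Fintype.card_fin]
    omega
  obtain ⟨y, hy, hy0⟩ := (Submodule.ne_bot_iff _).1 hker
  have hLy : L y = 0 := hy
  have y1 : ∀ j, ∑ i, y i j = 0 := fun j => congrFun (congrArg Prod.fst hLy) j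
  have y2' : ∀ i, i ≠ i0 → ∑ j, y i j = 0 := fun i hi =>
    congrFun (congrArg (fun z => z.2.1) hLy) ⟨i, hi⟩
  have y3 : ∀ i, ∑ j, y i j * t j = 0 := fun i => congrFun (congrArg (fun z => z.2.2.1) hLy) i
  have y4 : ∀ i j, x i j = 0 → y i j = 0 := fun i j h =>
    congrFun (congrArg (fun z => z.2.2.2) hLy) ⟨(i, j), h⟩
  have y2 : ∀ i, ∑ j, y i j = 0 := by
    intro i
    by_cases hi : i = i0
    · have h : ∑ i, ∑ j, y i j = 0 := by
        rw [Finset.sum_comm]; simp [y1]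
      rw [Finset.sum_eq_single i0 (fun i _ hi => y2' i hi) (by simp)] at h
      rw [hi, h]
    · exact y2' i hi
  have hev : ∀ᶠ ε in nhdsWithin (0 : ℝ) (Set.Ioi 0), ∀ i j, ε * |y i j| ≤ x i j := by
    rw [Filter.eventually_all]; intro i
    rw [Filter.eventually_all]; intro j
    rcases (h0 i j).eq_or_lt with h | h
    · simp [y4 i j h.symm, ← h]
    · apply Filter.Eventually.filter_mono nhdsWithin_le_nhds
      have hcont : Filter.Tendsto (fun ε : ℝ => ε * |y i j|) (nhds 0) (nhds (0 * |y i j|)) :=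
        (continuous_id.mul continuous_const).tendsto 0
      rw [zero_mul] at hcont
      exact hcont.eventually_le_const h
  obtain ⟨ε, hε, hpos⟩ := (hev.and self_mem_nhdsWithin).exists
  have hpos' : 0 < ε := hpos
  have key : ∀ c : ℝ, |c| = ε → x + c • y ∈ S := by
    intro c hcε
    rw [hS]
    refine ⟨fun i j => ?_, fun j => ?_, fun i => ?_, fun i => ?_⟩
    · have h := hε i j
      rw [← hcε, ← abs_mul] at h
      have := neg_abs_le (c * y i j)
      simp only [Pi.add_apply, Pi.smul_apply, smul_eq_mul]
      linarith
    · simp [Finset.sum_add_distrib, ← Finset.mul_sum, y1, h1]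
    · simpa [Finset.sum_add_distrib, ← Finset.mul_sum, y2] using h2 i
    · simpa [Finset.sum_add_distrib, ← Finset.mul_sum, add_mul, mul_assoc, y3] using h3 i
  have hseg : x ∈ openSegment ℝ (x + ε • y) (x + (-ε) • y) := by
    refine ⟨1 / 2, 1 / 2, by norm_num, by norm_num, by norm_num, ?_⟩
    ext i j
    simp only [Pi.add_apply, Pi.smul_apply, smul_eq_mul]
    ring
  have hfin := hx.2 (key ε (abs_of_pos hpos')) (key (-ε) (by rw [abs_neg, abs_of_pos hpos'])) hseg
  have h : ε • y = 0 := by simpa using hfin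
  rcases smul_eq_zero.1 h with h | h
  · exact hpos'.ne' h
  · exact hy0 h
end

section
/- Let k ≥ 1 machines have positive integer capacities m_1, …, m_k, let M ≥ 1 jobs have nonnegative real processing times t_1, …, t_M with M ≤ ∑_i m_i, let b : Fin k → ℝ, and let F ⊆ Fin k × Fin M be a finite set in which every job j occurs in at most one pair. Let S be the set of all x : Fin k → Fin M → ℝ satisfying: x i j ≥ 0 for all i, j; ∑_i x i j = 1 for every j; ∑_j x i j ≤ m_i for every i; ∑_j (x i j) * t_j ≤ b_i for every i; and x i j = 1 for every (i, j) ∈ F. Let c_i = |{j : (i, j) ∈ F}|, let k* be the number of machines i with c_i < m_i (free machines), and let M* be the number of jobs j with (i, j) ∉ F for all i (free jobs). If x is an extreme point of S (over ℝ), then the number of pairs (i, j) ∉ F with x i j > 0 is at most M* + 2k* − 1. -/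
/-- Support bound for basic solutions of BLPR(b, F): the number of supporting-graph
edges, i.e. pairs `(i, j) ∉ F` with `x i j > 0`, is at most `M* + 2k* - 1`, where
`M*` is the number of free jobs and `k*` the number of free machines. -/
theorem smcc_supporting_graph_edges_le
    (k M : ℕ) (hk : 1 ≤ k) (hM : 1 ≤ M)
    (m : Fin k → ℕ) (hm : ∀ i, 0 < m i)
    (t : Fin M → ℝ) (ht : ∀ j, 0 ≤ t j)
    (hMm : M ≤ ∑ i, m i)
    (b : Fin k → ℝ)
    (F : Finset (Fin k × Fin M))
    (hF : ∀ i i' j, (i, j) ∈ F → (i', j) ∈ F → i = i')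
    (S : Set (Fin k → Fin M → ℝ))
    (hS : S = {x | (∀ i j, 0 ≤ x i j) ∧ (∀ j, ∑ i, x i j = 1) ∧
        (∀ i, ∑ j, x i j ≤ (m i : ℝ)) ∧ (∀ i, ∑ j, x i j * t j ≤ b i) ∧
        (∀ p ∈ F, x p.1 p.2 = 1)})
    (c : Fin k → ℕ)
    (hc : ∀ i, c i = (F.filter (fun p => p.1 = i)).card)
    (kstar Mstar : ℕ)
    (hkstar : kstar = (Finset.univ.filter (fun i : Fin k => c i < m i)).card)
    (hMstar : Mstar = (Finset.univ.filter (fun j : Fin M => ∀ i, (i, j) ∉ F)).card)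
    (x : Fin k → Fin M → ℝ) (hx : x ∈ Set.extremePoints ℝ S) :
    {p : Fin k × Fin M | p ∉ F ∧ 0 < x p.1 p.2}.ncard ≤ Mstar + 2 * kstar - 1 := by
  classical
  subst hS
  have hxS := hx.1
  obtain ⟨h0, hJ, hC, hL, hFx⟩ := hxS
  -- nonfree columns and rows carry no edges
  have hcol : ∀ i i' j, (i', j) ∈ F → (i, j) ∉ F → x i j = 0 := by
    intro i i' j h h'
    have hne : i ≠ i' := by rintro rfl; exact h' h
    have h1 := hJ j
    have h2 : x i j + x i' j ≤ ∑ i, x i j := by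
      rw [← Finset.sum_pair (f := fun i => x i j) hne]
      exact Finset.sum_le_sum_of_subset_of_nonneg (Finset.subset_univ _) (fun a _ _ => h0 a j)
    have h3 := hFx _ h
    have h4 := h0 i j
    simp only at h3
    linarith
  have hcc : ∀ i, c i = (Finset.univ.filter (fun j => (i, j) ∈ F)).card := by
    intro i
    rw [hc i]
    refine Finset.card_bij (fun p _ => p.2) ?_ ?_ ?_
    · rintro ⟨a, j⟩ h
      simp only [Finset.mem_filter, Finset.mem_univ, true_and] at h ⊢
      obtain ⟨h, rfl⟩ := h
      exact h
    · rintro ⟨a, j⟩ h ⟨a', j'⟩ h' e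
      simp only [Finset.mem_filter] at h h' e
      rw [h.2, h'.2, e]
    · intro j h
      simp only [Finset.mem_filter, Finset.mem_univ, true_and] at h
      exact ⟨(i, j), by simp [h], rfl⟩
  have hrowsum : ∀ i, ∑ j ∈ Finset.univ.filter (fun j => (i, j) ∈ F), x i j = c i := by
    intro i
    rw [hcc i, Finset.sum_congr rfl (g := fun _ => (1 : ℝ))]
    · simp
    · intro j hj
      exact hFx (i, j) (Finset.mem_filter.1 hj).2
  have hrow : ∀ i j, ¬ c i < m i → (i, j) ∉ F → x i j = 0 := by
    intro i j hi hij
    have h1 := hC i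
    have h2 : x i j + ∑ j ∈ Finset.univ.filter (fun j => (i, j) ∈ F), x i j ≤ ∑ j, x i j := by
      rw [← Finset.sum_insert (f := fun j => x i j) (by simp [hij])]
      exact Finset.sum_le_sum_of_subset_of_nonneg (Finset.subset_univ _) (fun a _ _ => h0 i a)
    rw [hrowsum] at h2
    have h3 : (m i : ℝ) ≤ c i := by exact_mod_cast not_lt.1 hi
    have h4 := h0 i j
    linarith
  set E : Finset (Fin k × Fin M) := Finset.univ.filter (fun p => p ∉ F ∧ 0 < x p.1 p.2) with hE
  have hset : {p : Fin k × Fin M | p ∉ F ∧ 0 < x p.1 p.2} = (E : Set (Fin k × Fin M)) := by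
    ext p; simp [hE]
  rw [hset, Set.ncard_coe_finset]
  by_contra hcon
  push Not at hcon
  have hEne : E.Nonempty := Finset.card_pos.1 (by omega)
  obtain ⟨p0, hp0⟩ := hEne
  have hEmem : ∀ p ∈ E, p ∉ F ∧ 0 < x p.1 p.2 := fun p hp => by simpa [hE] using hp
  have hEfree : ∀ p ∈ E, c p.1 < m p.1 := by
    intro p hp
    by_contra h
    have := hrow p.1 p.2 h (hEmem p hp).1
    linarith [(hEmem p hp).2]
  have hEjob : ∀ p ∈ E, ∀ i, (i, p.2) ∉ F := by
    intro p hp i h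
    have := hcol p.1 i p.2 h (hEmem p hp).1
    linarith [(hEmem p hp).2]
  set K : Finset (Fin k) := Finset.univ.filter (fun i : Fin k => c i < m i) with hK
  set J : Finset (Fin M) := Finset.univ.filter (fun j : Fin M => ∀ i, (i, j) ∉ F) with hJdef
  have hi0 : p0.1 ∈ K := by simp [hK, hEfree p0 hp0]
  have hKpos : 0 < K.card := Finset.card_pos.2 ⟨_, hi0⟩
  let L : (Fin k × Fin M → ℝ) →ₗ[ℝ]
      ((Eᶜ : Finset _) → ℝ) × (J → ℝ) × ((K.erase p0.1 : Finset _) → ℝ) × (K → ℝ) :=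
    { toFun := fun d => (fun p => d p.1, fun j => ∑ i, d (i, j.1), fun i => ∑ j, d (i.1, j),
        fun i => ∑ j, d (i.1, j) * t j)
      map_add' := by
        intro d e
        ext <;> simp [Finset.sum_add_distrib, add_mul]
      map_smul' := by
        intro r d
        ext <;> simp [Finset.mul_sum, mul_assoc] }
  have hker : LinearMap.ker L ≠ ⊥ := by
    apply LinearMap.ker_ne_bot_of_finrank_lt
    simp only [Module.finrank_prod, Module.finrank_fintype_fun_eq_card, Fintype.card_coe]
    have h1 := Finset.card_add_card_compl E
    have h2 := Finset.card_erase_of_mem hi0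
    omega
  obtain ⟨d, hd, hd0⟩ := Submodule.exists_mem_ne_zero_of_ne_bot hker
  have hd' : L d = 0 := hd
  simp only [L, LinearMap.coe_mk, AddHom.coe_mk, Prod.mk_eq_zero, funext_iff, Pi.zero_apply,
    Subtype.forall] at hd'
  obtain ⟨dE, dJ, dK, dL⟩ := hd'
  have dE' : ∀ p, p ∉ E → d p = 0 := fun p hp => dE p (Finset.mem_compl.2 hp)
  have dJ' : ∀ j, ∑ i, d (i, j) = 0 := by
    intro j
    by_cases h : j ∈ J
    · exact dJ j h
    · refine Finset.sum_eq_zero fun i _ => dE' _ fun hm => h ?_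
      simpa [hJdef] using hEjob _ hm
  have dnK : ∀ i, i ∉ K → ∀ j, d (i, j) = 0 := by
    intro i h j
    refine dE' _ fun hm => h ?_
    simpa [hK] using hEfree _ hm
  have dK1 : ∀ i, i ≠ p0.1 → ∑ j, d (i, j) = 0 := by
    intro i hi
    by_cases h : i ∈ K
    · exact dK i (Finset.mem_erase.2 ⟨hi, h⟩)
    · exact Finset.sum_eq_zero fun j _ => dnK i h j
  have dK' : ∀ i, ∑ j, d (i, j) = 0 := by
    intro i
    by_cases hi : i = p0.1
    · have h1 : ∑ i, ∑ j, d (i, j) = 0 := by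
        rw [Finset.sum_comm]
        exact Finset.sum_eq_zero fun j _ => dJ' j
      rw [Finset.sum_eq_single p0.1 (fun i _ h => dK1 i h) (by simp)] at h1
      rw [hi, h1]
    · exact dK1 i hi
  have dL' : ∀ i, ∑ j, d (i, j) * t j = 0 := by
    intro i
    by_cases h : i ∈ K
    · exact dL i h
    · exact Finset.sum_eq_zero fun j _ => by rw [dnK i h j, zero_mul]
  have hEF : ∀ p ∈ F, d p = 0 := fun p hp => dE' p fun h => (hEmem p h).1 hp
  obtain ⟨q, hq, hqmin⟩ := Finset.exists_min_image E (fun p => x p.1 p.2) ⟨p0, hp0⟩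
  have hqpos := (hEmem q hq).2
  have hDpos : 0 < ∑ p, |d p| + 1 := by positivity
  set ε : ℝ := x q.1 q.2 / (∑ p, |d p| + 1) with hε
  have hεpos : 0 < ε := div_pos hqpos hDpos
  have hbound : ∀ i j, |ε * d (i, j)| ≤ x i j := by
    intro i j
    by_cases h : (i, j) ∈ E
    · have h1 := hqmin _ h
      have h2 : |d (i, j)| ≤ ∑ p, |d p| + 1 := by
        have := Finset.single_le_sum (f := fun p => |d p|) (fun p _ => abs_nonneg (d p))
          (Finset.mem_univ (i, j))
        linarith
      rw [abs_mul, abs_of_pos hεpos]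
      calc ε * |d (i, j)| ≤ ε * (∑ p, |d p| + 1) := by gcongr
        _ = x q.1 q.2 := by rw [hε]; field_simp
        _ ≤ x i j := h1
    · rw [dE' _ h]; simpa using h0 i j
  have hfeas : ∀ s : ℝ, |s| = 1 → (fun i j => x i j + s * (ε * d (i, j))) ∈
      {x : Fin k → Fin M → ℝ | (∀ i j, 0 ≤ x i j) ∧ (∀ j, ∑ i, x i j = 1) ∧
        (∀ i, ∑ j, x i j ≤ (m i : ℝ)) ∧ (∀ i, ∑ j, x i j * t j ≤ b i) ∧
        (∀ p ∈ F, x p.1 p.2 = 1)} := by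
    intro s hs
    refine ⟨?_, ?_, ?_, ?_, ?_⟩
    · intro i j
      have h1 := hbound i j
      have h2 : |s * (ε * d (i, j))| ≤ x i j := by rwa [abs_mul, hs, one_mul]
      have := (abs_le.1 h2).1
      simp only
      linarith
    · intro j
      simp only [Finset.sum_add_distrib, ← Finset.mul_sum, dJ', hJ, mul_zero, add_zero]
    · intro i
      simp only [Finset.sum_add_distrib, ← Finset.mul_sum, dK', mul_zero, add_zero]
      exact hC i
    · intro i
      simp only [add_mul, mul_assoc, Finset.sum_add_distrib, ← Finset.mul_sum, dL', mul_zero,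
        add_zero]
      exact hL i
    · intro p hp
      have := hEF p hp
      simp only [Prod.mk.eta, this, mul_zero, add_zero]
      exact hFx p hp
  have hseg : x ∈ openSegment ℝ (fun i j => x i j + 1 * (ε * d (i, j)))
      (fun i j => x i j + (-1) * (ε * d (i, j))) := by
    refine ⟨1 / 2, 1 / 2, by norm_num, by norm_num, by norm_num, ?_⟩
    ext i j
    simp only [Pi.add_apply, Pi.smul_apply, smul_eq_mul]
    ring
  have heq := hx.2 (hfeas 1 (by simp)) (hfeas (-1) (by simp)) hseg
  apply hd0
  ext ⟨i, j⟩
  have h1 := congrFun (congrFun heq i) j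
  simp only [one_mul, add_eq_left, mul_eq_zero] at h1
  exact h1.resolve_left hεpos.ne'
end

section
/- Let k ≥ 1 machines have positive integer capacities m_1, …, m_k, let M ≥ 1 jobs have nonnegative real processing times t_1, …, t_M with M ≤ ∑_i m_i, let b : Fin k → ℝ, and let F ⊆ Fin k × Fin M be a finite set in which every job occurs in at most one pair. Let S be the BLPR(b, F) feasible set, let k* be the number of free machines and M* the number of free jobs, and assume M* ≥ 2k* and M* ≥ 1. If x is an extreme point of S (over ℝ), then there exist a free machine p and a free job q with x p q = 1. -/
/-- If `M* ≥ 2k*` and there is at least one free job, a basic solution of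
BLPR(b, F) has a free machine `p` and a free job `q` with `x p q = 1`. -/
theorem smcc_exists_integral_pair
    (k M : ℕ) (hk : 1 ≤ k) (hM : 1 ≤ M)
    (m : Fin k → ℕ) (hm : ∀ i, 0 < m i)
    (t : Fin M → ℝ) (ht : ∀ j, 0 ≤ t j)
    (hMm : M ≤ ∑ i, m i)
    (b : Fin k → ℝ)
    (F : Finset (Fin k × Fin M))
    (hF : ∀ i i' j, (i, j) ∈ F → (i', j) ∈ F → i = i')
    (S : Set (Fin k → Fin M → ℝ))
    (hS : S = {x | (∀ i j, 0 ≤ x i j) ∧ (∀ j, ∑ i, x i j = 1) ∧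
        (∀ i, ∑ j, x i j ≤ (m i : ℝ)) ∧ (∀ i, ∑ j, x i j * t j ≤ b i) ∧
        (∀ p ∈ F, x p.1 p.2 = 1)})
    (c : Fin k → ℕ)
    (hc : ∀ i, c i = (F.filter (fun p => p.1 = i)).card)
    (kstar Mstar : ℕ)
    (hkstar : kstar = (Finset.univ.filter (fun i : Fin k => c i < m i)).card)
    (hMstar : Mstar = (Finset.univ.filter (fun j : Fin M => ∀ i, (i, j) ∉ F)).card)
    (hbig : 2 * kstar ≤ Mstar) (hpos : 1 ≤ Mstar)
    (x : Fin k → Fin M → ℝ) (hx : x ∈ Set.extremePoints ℝ S) :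
    ∃ p q, c p < m p ∧ (∀ i, (i, q) ∉ F) ∧ x p q = 1 := by
  classical
  by_contra hcon
  push Not at hcon
  obtain ⟨hxS, hext⟩ := hx
  have hxS' := hxS
  rw [hS] at hxS'
  obtain ⟨hx0, hxcol, hxcap, hxload, hxF⟩ := hxS'
  have hfree : ∀ i j, (∀ i', (i', j) ∉ F) → 0 < x i j → c i < m i := by
    intro i j hj hpos'
    by_contra hlt
    push Not at hlt
    have h1 : ((F.filter (fun p => p.1 = i)).image Prod.snd).card = c i := by
      rw [hc, Finset.card_image_of_injOn]
      rintro ⟨a, b⟩ ha ⟨a', b'⟩ ha' h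
      simp at ha ha' h
      simp [ha.2, ha'.2, h]
    have h2 : ∑ j' ∈ (F.filter (fun p => p.1 = i)).image Prod.snd, x i j' = (c i : ℝ) := by
      rw [← h1, Finset.cast_card]
      apply Finset.sum_congr rfl
      intro j' hj'
      simp only [Finset.mem_image, Finset.mem_filter] at hj'
      obtain ⟨p, ⟨hp, hpi⟩, rfl⟩ := hj'
      rw [← hpi]
      exact hxF p hp
    have hnot : j ∉ (F.filter (fun p => p.1 = i)).image Prod.snd := by
      intro h
      simp only [Finset.mem_image, Finset.mem_filter] at h
      obtain ⟨p, ⟨hp, _⟩, rfl⟩ := h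
      exact hj p.1 hp
    have h3 : ∑ j' ∈ insert j ((F.filter (fun p => p.1 = i)).image Prod.snd), x i j'
        ≤ ∑ j', x i j' :=
      Finset.sum_le_sum_of_subset_of_nonneg (Finset.subset_univ _) (fun j' _ _ => hx0 i j')
    rw [Finset.sum_insert hnot, h2] at h3
    have h4 : (m i : ℝ) ≤ c i := by exact_mod_cast hlt
    linarith [hxcap i]
  set FM := Finset.univ.filter (fun i : Fin k => c i < m i) with hFM
  set FJ := Finset.univ.filter (fun j : Fin M => ∀ i, (i, j) ∉ F) with hFJ
  let P : Finset (Fin k × Fin M) :=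
    Finset.univ.filter (fun p => p.2 ∈ FJ ∧ 0 < x p.1 p.2)
  have hPmem : ∀ p, p ∈ P ↔ (∀ i, (i, p.2) ∉ F) ∧ 0 < x p.1 p.2 := by
    intro p; simp [P, hFJ]
  have hPcard : 2 * Mstar ≤ P.card := by
    have hmaps : ∀ p ∈ P, p.2 ∈ FJ := by
      intro p hp
      simp only [P, Finset.mem_filter] at hp
      exact hp.2.1
    rw [Finset.card_eq_sum_card_fiberwise (f := Prod.snd) (t := FJ) hmaps, hMstar, mul_comm,
      ← smul_eq_mul]
    apply Finset.card_nsmul_le_sum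
    intro j hj
    have hj' : ∀ i, (i, j) ∉ F := by simpa [hFJ] using hj
    have hex : ∃ i0, 0 < x i0 j := by
      by_contra hno
      push Not at hno
      have : ∑ i, x i j ≤ 0 := Finset.sum_nonpos (fun i _ => hno i)
      linarith [hxcol j]
    obtain ⟨i0, hi0⟩ := hex
    have hex2 : ∃ i1, i1 ≠ i0 ∧ 0 < x i1 j := by
      by_contra hno
      push Not at hno
      have : ∑ i, x i j = x i0 j :=
        Finset.sum_eq_single i0 (fun i _ hi => le_antisymm (hno i hi) (hx0 i j)) (by simp)
      exact hcon i0 j (hfree i0 j hj' hi0) hj' (by rw [← this, hxcol j])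
    obtain ⟨i1, hne, hi1⟩ := hex2
    have hsub : ({(i0, j), (i1, j)} : Finset (Fin k × Fin M)) ⊆ P.filter (fun p => p.2 = j) := by
      intro p hp
      simp only [Finset.mem_insert, Finset.mem_singleton] at hp
      rw [Finset.mem_filter, hPmem]
      rcases hp with rfl | rfl
      · exact ⟨⟨hj', hi0⟩, rfl⟩
      · exact ⟨⟨hj', hi1⟩, rfl⟩
    have h2 : ({(i0, j), (i1, j)} : Finset (Fin k × Fin M)).card = 2 := by
      apply Finset.card_pair
      intro h
      exact hne (congrArg Prod.fst h).symm
    have := Finset.card_le_card hsub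
    rw [h2] at this
    exact this
  have hFJne : FJ.Nonempty := by
    rw [← Finset.card_pos]; omega
  obtain ⟨q0, hq0⟩ := hFJne
  let E : (P → ℝ) →ₗ[ℝ] (Fin k → Fin M → ℝ) :=
    { toFun := fun v i j => if h : (i, j) ∈ P then v ⟨(i, j), h⟩ else 0
      map_add' := by
        intro u v; funext i j
        by_cases h : (i, j) ∈ P <;> simp [h]
      map_smul' := by
        intro r v; funext i j
        by_cases h : (i, j) ∈ P <;> simp [h] }
  have hEz : ∀ v i j, (i, j) ∉ P → E v i j = 0 := by
    intro v i j h
    exact dif_neg h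
  have hEp : ∀ v (p : P), E v p.1.1 p.1.2 = v p := by
    intro v p
    exact dif_pos p.2
  let C : (Fin k → Fin M → ℝ) →ₗ[ℝ] ((FJ.erase q0 → ℝ) × (FM → ℝ) × (FM → ℝ)) :=
    { toFun := fun y => (fun j => ∑ i, y i j, fun i => ∑ j, y i j, fun i => ∑ j, y i j * t j)
      map_add' := by
        intro u v
        ext <;> simp [Finset.sum_add_distrib, add_mul]
      map_smul' := by
        intro r v
        ext <;> simp [Finset.mul_sum, mul_assoc] }
  have hker : LinearMap.ker (C ∘ₗ E) ≠ ⊥ := by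
    apply LinearMap.ker_ne_bot_of_finrank_lt
    simp only [Module.finrank_prod, Module.finrank_fintype_fun_eq_card, Fintype.card_coe,
      Finset.card_erase_of_mem hq0]
    omega
  obtain ⟨v, hv, hvne⟩ := (Submodule.ne_bot_iff _).1 hker
  have hCv : C (E v) = 0 := by simpa using hv
  set y := E v with hy
  have hrowz : ∀ i, i ∉ FM → ∀ j, y i j = 0 := by
    intro i hi j
    apply hEz
    intro h
    rw [hPmem] at h
    exact hi (by simpa [hFM] using hfree i j h.1 h.2)
  have hrow : ∀ i, ∑ j, y i j = 0 := by
    intro i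
    by_cases hi : i ∈ FM
    · exact congrFun (congrArg (fun z => z.2.1) hCv) ⟨i, hi⟩
    · exact Finset.sum_eq_zero (fun j _ => hrowz i hi j)
  have hload : ∀ i, ∑ j, y i j * t j = 0 := by
    intro i
    by_cases hi : i ∈ FM
    · exact congrFun (congrArg (fun z => z.2.2) hCv) ⟨i, hi⟩
    · exact Finset.sum_eq_zero (fun j _ => by rw [hrowz i hi j, zero_mul])
  have hcol' : ∀ j, j ≠ q0 → ∑ i, y i j = 0 := by
    intro j hj
    by_cases hjF : j ∈ FJ
    · exact congrFun (congrArg (fun z => z.1) hCv) ⟨j, Finset.mem_erase.2 ⟨hj, hjF⟩⟩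
    · apply Finset.sum_eq_zero
      intro i _
      apply hEz
      intro h
      rw [hPmem] at h
      exact hjF (by simpa [hFJ] using h.1)
  have hcol : ∀ j, ∑ i, y i j = 0 := by
    intro j
    by_cases hj : j = q0
    · subst hj
      have h1 : ∑ j', ∑ i, y i j' = 0 := by
        rw [Finset.sum_comm]
        exact Finset.sum_eq_zero (fun i _ => hrow i)
      rw [← h1]
      exact (Finset.sum_eq_single j (fun j' _ h => hcol' j' h) (by simp)).symm
    · exact hcol' j hj
  have hPne : P.Nonempty := by
    rw [← Finset.card_pos]; omega
  obtain ⟨p0, hp0, hmin⟩ := Finset.exists_min_image P (fun p => x p.1 p.2 / (|y p.1 p.2| + 1)) hPne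
  obtain ⟨ε, hε⟩ : ∃ ε, ε = x p0.1 p0.2 / (|y p0.1 p0.2| + 1) := ⟨_, rfl⟩
  have hεpos : 0 < ε := by
    rw [hε]
    have := ((hPmem p0).1 hp0).2
    positivity
  have hbd : ∀ i j, ε * |y i j| ≤ x i j := by
    intro i j
    by_cases h : (i, j) ∈ P
    · have h1 := hmin (i, j) h
      simp only [← hε] at h1
      rw [le_div_iff₀ (by positivity)] at h1
      linarith
    · rw [hy, hEz v i j h]
      simpa using hx0 i j
  have hmemS : ∀ r : ℝ, |r| = ε → (fun i j => x i j + r * y i j) ∈ S := by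
    intro r hr
    rw [hS]
    refine ⟨?_, ?_, ?_, ?_, ?_⟩
    · intro i j
      have h1 := hbd i j
      rw [← hr, ← abs_mul] at h1
      have := neg_abs_le (r * y i j)
      show 0 ≤ x i j + r * y i j
      linarith
    · intro j
      simp only [Finset.sum_add_distrib, ← Finset.mul_sum, hcol, hxcol]
      simp
    · intro i
      simp only [Finset.sum_add_distrib, ← Finset.mul_sum, hrow]
      simpa using hxcap i
    · intro i
      simp only [add_mul, mul_assoc, Finset.sum_add_distrib, ← Finset.mul_sum, hload]
      simpa using hxload i
    · intro p hp
      have : y p.1 p.2 = 0 := by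
        apply hEz
        intro h
        rw [hPmem] at h
        exact h.1 p.1 hp
      simp only [this, hxF p hp]
      simp
  have hseg : x ∈ openSegment ℝ (fun i j => x i j + ε * y i j)
      (fun i j => x i j + (-ε) * y i j) := by
    refine ⟨1 / 2, 1 / 2, by norm_num, by norm_num, by norm_num, ?_⟩
    funext i j
    simp only [Pi.add_apply, Pi.smul_apply, smul_eq_mul]
    ring
  have heq := hext (hmemS ε (abs_of_pos hεpos)) (hmemS (-ε) (by rw [abs_neg, abs_of_pos hεpos])) hseg
  apply hvne
  funext p
  have h1 := congrFun (congrFun heq p.1.1) p.1.2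
  have h2 : ε * y p.1.1 p.1.2 = 0 := by
    simpa using h1
  rw [hy, hEp] at h2
  exact (mul_eq_zero.1 h2).resolve_left hεpos.ne'
end

section
/- Let k ≥ 1 machines have positive integer capacities m_1, …, m_k, let M ≥ 1 jobs have nonnegative real processing times t_1, …, t_M with M ≤ ∑_i m_i, let b : Fin k → ℝ, and let F ⊆ Fin k × Fin M be a finite set in which every job occurs in at most one pair. Suppose the BLPR(b, F) feasible set is nonempty, the numbers of free jobs and free machines satisfy M* < 2k* and M* ≥ 1, machine p is free with exactly one unit of free capacity (m_p − c_p = 1), and q is a free job whose processing time t_q is maximal among all free jobs. Define b' : Fin k → ℝ by b'_p = b_p + t_q and b'_i = b_i for i ≠ p. Then the BLPR(b', F ∪ {(p, q)}) feasible set is nonempty. -/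
/-- G-transition feasibility: if `M* < 2k*`, machine `p` is free with exactly one
unit of free capacity, and `q` is a free job of maximal processing time among free
jobs, then assigning `q` to `p` and raising `b p` by `t q` preserves feasibility. -/
theorem smcc_g_transition_feasible
    (k M : ℕ) (hk : 1 ≤ k) (hM : 1 ≤ M)
    (m : Fin k → ℕ) (hm : ∀ i, 0 < m i)
    (t : Fin M → ℝ) (ht : ∀ j, 0 ≤ t j)
    (hMm : M ≤ ∑ i, m i)
    (b : Fin k → ℝ)
    (F : Finset (Fin k × Fin M))
    (hF : ∀ i i' j, (i, j) ∈ F → (i', j) ∈ F → i = i')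
    (S : Set (Fin k → Fin M → ℝ))
    (hS : S = {x | (∀ i j, 0 ≤ x i j) ∧ (∀ j, ∑ i, x i j = 1) ∧
        (∀ i, ∑ j, x i j ≤ (m i : ℝ)) ∧ (∀ i, ∑ j, x i j * t j ≤ b i) ∧
        (∀ p ∈ F, x p.1 p.2 = 1)})
    (hne : S.Nonempty)
    (c : Fin k → ℕ)
    (hc : ∀ i, c i = (F.filter (fun p => p.1 = i)).card)
    (kstar Mstar : ℕ)
    (hkstar : kstar = (Finset.univ.filter (fun i : Fin k => c i < m i)).card)
    (hMstar : Mstar = (Finset.univ.filter (fun j : Fin M => ∀ i, (i, j) ∉ F)).card)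
    (hsmall : Mstar < 2 * kstar) (hpos : 1 ≤ Mstar)
    (p : Fin k) (hp : m p = c p + 1)
    (q : Fin M) (hq : ∀ i, (i, q) ∉ F)
    (hqmax : ∀ j : Fin M, (∀ i, (i, j) ∉ F) → t j ≤ t q)
    (b' : Fin k → ℝ) (hb' : b' = Function.update b p (b p + t q))
    (S' : Set (Fin k → Fin M → ℝ))
    (hS' : S' = {x | (∀ i j, 0 ≤ x i j) ∧ (∀ j, ∑ i, x i j = 1) ∧
        (∀ i, ∑ j, x i j ≤ (m i : ℝ)) ∧ (∀ i, ∑ j, x i j * t j ≤ b' i) ∧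
        (∀ r ∈ insert (p, q) F, x r.1 r.2 = 1)}) :
    S'.Nonempty := by
  subst hS hS' hb'
  obtain ⟨x, hx0, hcol, hcap, hload, hfix⟩ := hne
  have hle1 : ∀ i j, x i j ≤ 1 := fun i j => by
    rw [← hcol j]
    exact Finset.single_le_sum (f := fun i => x i j) (fun i _ => hx0 i j) (Finset.mem_univ i)
  rcases eq_or_lt_of_le (hle1 p q) with h1 | hlt
  · refine ⟨x, hx0, hcol, hcap, fun i => (hload i).trans ?_, ?_⟩
    · by_cases hi : i = p
      · subst hi
        simpa using ht q
      · simp [hi]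
    · intro r hr
      rcases Finset.mem_insert.1 hr with rfl | hr
      · exact h1
      · exact hfix r hr
  have hα : 0 < 1 - x p q := by linarith
  -- entries of machine `p` at jobs fixed elsewhere vanish
  have hzero : ∀ i j, (i, j) ∈ F → i ≠ p → x p j = 0 := by
    intro i j hij hip
    have h2 : x i j + x p j ≤ ∑ i, x i j := by
      rw [← Finset.sum_pair (f := fun i => x i j) hip]
      exact Finset.sum_le_sum_of_subset_of_nonneg (Finset.subset_univ _)
        (fun i _ _ => hx0 i j)
    have h3 : x i j = 1 := hfix _ hij
    have h4 := hcol j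
    have h5 := hx0 p j
    linarith
  obtain ⟨d, hd⟩ : ∃ d : Fin M → ℝ, ∀ j, d j = if j = q ∨ (p, j) ∈ F then 0 else x p j :=
    ⟨_, fun _ => rfl⟩
  obtain ⟨w, hw⟩ : ∃ w : Fin k → ℝ, ∀ i, w i = if i = p then 0 else x i q / (1 - x p q) :=
    ⟨_, fun _ => rfl⟩
  have hd0 : ∀ j, 0 ≤ d j := fun j => by
    rw [hd]; split_ifs
    · exact le_rfl
    · exact hx0 p j
  have hdq : d q = 0 := by simp [hd]
  have hwp : w p = 0 := by simp [hw]
  have hwi : ∀ i, i ≠ p → w i * (1 - x p q) = x i q := fun i hi => by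
    rw [hw, if_neg hi]; field_simp
  have hw0 : ∀ i, 0 ≤ w i := fun i => by
    rw [hw]; split_ifs
    · exact le_rfl
    · exact div_nonneg (hx0 i q) hα.le
  have hwsum : ∑ i, w i = 1 := by
    have h : ∑ i, w i * (1 - x p q) = ∑ i, (x i q - if i = p then x p q else 0) := by
      refine Finset.sum_congr rfl fun i _ => ?_
      by_cases hi : i = p
      · subst hi; simp [hwp]
      · rw [hwi i hi]; simp [hi]
    rw [← Finset.sum_mul, Finset.sum_sub_distrib, hcol q] at h
    simp only [Finset.sum_ite_eq', Finset.mem_univ, if_true] at h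
    exact mul_right_cancel₀ hα.ne' (by linarith)
  have hdec : ∀ j, x p j = d j + (if j = q then x p q else 0)
      + (if (p, j) ∈ F then 1 else 0) := by
    intro j
    rw [hd]
    by_cases hj : j = q
    · subst hj; simp [hq p]
    · by_cases hjF : (p, j) ∈ F
      · simpa [hj, hjF] using hfix _ hjF
      · simp [hj, hjF]
  have hcount : ∑ j, (if (p, j) ∈ F then (1:ℝ) else 0) = c p := by
    rw [Finset.sum_boole, hc]
    congr 1
    refine Finset.card_bij (fun j _ => (p, j)) ?_ ?_ ?_
    · intro j hj
      simpa using hj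
    · intro a _ b _ h
      exact (Prod.mk.inj h).2
    · rintro ⟨i, j⟩ hb
      simp only [Finset.mem_filter] at hb
      obtain ⟨hb, rfl⟩ := hb
      exact ⟨j, by simpa using hb, rfl⟩
  have hprow : ∑ j, x p j = ∑ j, d j + x p q + c p := by
    rw [Finset.sum_congr rfl fun j _ => hdec j, Finset.sum_add_distrib,
      Finset.sum_add_distrib, hcount]
    simp
  have hmp : (m p : ℝ) = c p + 1 := by exact_mod_cast hp
  have hdsum : ∑ j, d j ≤ 1 - x p q := by
    have := hcap p
    linarith
  have hdt : ∀ j, d j * t j ≤ d j * t q := by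
    intro j
    by_cases h : ∀ i, (i, j) ∉ F
    · exact mul_le_mul_of_nonneg_left (hqmax j h) (hd0 j)
    · push Not at h
      obtain ⟨i, hi⟩ := h
      have : d j = 0 := by
        rw [hd]; split_ifs with h'
        · rfl
        · refine hzero i j hi ?_
          rintro rfl
          exact h' (Or.inr hi)
      simp [this]
  have hdtsum : ∑ j, d j * t j ≤ (1 - x p q) * t q := by
    calc ∑ j, d j * t j ≤ ∑ j, d j * t q := Finset.sum_le_sum fun j _ => hdt j
      _ = (∑ j, d j) * t q := by rw [Finset.sum_mul]
      _ ≤ _ := mul_le_mul_of_nonneg_right hdsum (ht q)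
  have hdt0 : 0 ≤ ∑ j, d j * t j := Finset.sum_nonneg fun j _ => mul_nonneg (hd0 j) (ht j)
  obtain ⟨u, hu⟩ : ∃ u : Fin k → ℝ, ∀ i, u i = if i = p then 1 else 0 := ⟨_, fun _ => rfl⟩
  obtain ⟨v, hv⟩ : ∃ v : Fin M → ℝ, ∀ j, v j = if j = q then 1 else 0 := ⟨_, fun _ => rfl⟩
  have husum : ∑ i, u i = 1 := by simp [hu]
  have hvsum : ∑ j, v j = 1 := by simp [hv]
  have hvt : ∑ j, v j * t j = t q := by simp [hv]
  have hup : u p = 1 := by simp [hu]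
  have hui : ∀ i, i ≠ p → u i = 0 := fun i hi => by simp [hu, hi]
  have hvq : v q = 1 := by simp [hv]
  have hvj : ∀ j, j ≠ q → v j = 0 := fun j hj => by simp [hv, hj]
  refine ⟨fun i j => x i j + (u i - x i q) * v j + (w i - u i) * d j, ?_, ?_, ?_, ?_, ?_⟩
  · intro i j
    have h0 := hx0 i j
    by_cases hi : i = p
    · subst hi
      by_cases hj : j = q
      · subst hj; simp [hup, hvq, hdq]
      · have h := hdec j
        simp only [hj, if_false] at h
        simp only [hup, hvj j hj, hwp]
        split_ifs at h <;> linarith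
    · have hwd := mul_nonneg (hw0 i) (hd0 j)
      by_cases hj : j = q
      · subst hj; simp [hui i hi, hvq, hdq]
      · simp only [hui i hi, hvj j hj]
        linarith
  · intro j
    simp only [Finset.sum_add_distrib, ← Finset.sum_mul, Finset.sum_sub_distrib, hcol, husum,
      hwsum]
    ring
  · intro i
    simp only [Finset.sum_add_distrib, ← Finset.mul_sum, hvsum]
    by_cases hi : i = p
    · subst hi
      rw [hup, hwp]; linarith
    · have h1 := mul_le_mul_of_nonneg_left hdsum (hw0 i)
      rw [hwi i hi] at h1
      have := hcap i
      rw [hui i hi]; linarith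
  · intro i
    have hrow : ∑ j, (x i j + (u i - x i q) * v j + (w i - u i) * d j) * t j
        = ∑ j, x i j * t j + (u i - x i q) * t q + (w i - u i) * ∑ j, d j * t j := by
      rw [← hvt, Finset.mul_sum, Finset.mul_sum, ← Finset.sum_add_distrib,
        ← Finset.sum_add_distrib]
      exact Finset.sum_congr rfl fun j _ => by ring
    have hl := hload i
    refine hrow.le.trans ?_
    by_cases hi : i = p
    · subst hi
      have := mul_nonneg (hx0 i q) (ht q)
      simp only [Function.update_self, hup, hwp]
      linarith
    · have h1 := mul_le_mul_of_nonneg_left hdtsum (hw0 i)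
      rw [← mul_assoc, hwi i hi] at h1
      simp only [Function.update_of_ne hi, hui i hi]
      linarith
  · rintro ⟨i, j⟩ hins
    rcases Finset.mem_insert.1 hins with h | hr
    · obtain ⟨rfl, rfl⟩ := Prod.mk.inj h
      simp [hup, hvq, hdq]
    · have hjq : j ≠ q := by
        rintro rfl; exact hq i hr
      have hdj : d j = 0 := by
        rw [hd]; split_ifs with h'
        · rfl
        · refine hzero i j hr ?_
          rintro rfl
          exact h' (Or.inr hr)
      have h3 : x i j = 1 := hfix _ hr
      simp [hvj j hjq, hdj, h3]
end

section
/- Let k ≥ 1 machines have positive integer capacities m_1, …, m_k, let M ≥ 1 jobs have nonnegative real processing times t_1, …, t_M with M ≤ ∑_i m_i, let b : Fin k → ℝ, and let F ⊆ Fin k × Fin M be a finite set in which every job occurs in at most one pair. Suppose the BLPR(b, F) feasible set is nonempty, the numbers of free jobs and free machines satisfy M* < 2k*, and every free machine i has free capacity m_i − c_i ≥ 2. Then there exists a function σ from the set of free jobs to the set of free machines such that each free machine receives at most 2 free jobs under σ, and the integral assignment extending F by {(σ(j), j) : j free} is a fractional schedule (in particular it respects all capacities), with load on each machine p at most b_p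 + ∑_{j free, σ(j) = p} t_j. -/
/-- H-transition: if `M* < 2k*` and every free machine has at least two units of
free capacity, the free jobs can be assigned to free machines, at most two per
machine, so that the resulting 0/1 assignment extending `F` is a fractional
schedule whose load on each machine `p` is at most `b p` plus the total length
of the free jobs assigned to `p`. -/
theorem smcc_h_transition
    (k M : ℕ) (hk : 1 ≤ k) (hM : 1 ≤ M)
    (m : Fin k → ℕ) (hm : ∀ i, 0 < m i)
    (t : Fin M → ℝ) (ht : ∀ j, 0 ≤ t j)
    (hMm : M ≤ ∑ i, m i)
    (b : Fin k → ℝ)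
    (F : Finset (Fin k × Fin M))
    (hF : ∀ i i' j, (i, j) ∈ F → (i', j) ∈ F → i = i')
    (S : Set (Fin k → Fin M → ℝ))
    (hS : S = {x | (∀ i j, 0 ≤ x i j) ∧ (∀ j, ∑ i, x i j = 1) ∧
        (∀ i, ∑ j, x i j ≤ (m i : ℝ)) ∧ (∀ i, ∑ j, x i j * t j ≤ b i) ∧
        (∀ p ∈ F, x p.1 p.2 = 1)})
    (hne : S.Nonempty)
    (c : Fin k → ℕ)
    (hc : ∀ i, c i = (F.filter (fun p => p.1 = i)).card)
    (kstar Mstar : ℕ)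
    (hkstar : kstar = (Finset.univ.filter (fun i : Fin k => c i < m i)).card)
    (hMstar : Mstar = (Finset.univ.filter (fun j : Fin M => ∀ i, (i, j) ∉ F)).card)
    (hsmall : Mstar < 2 * kstar)
    (hcap : ∀ i, c i < m i → c i + 2 ≤ m i) :
    ∃ σ : Fin M → Fin k,
      (∀ j, (∀ i, (i, j) ∉ F) → c (σ j) < m (σ j)) ∧
      (∀ p, (Finset.univ.filter
          (fun j : Fin M => (∀ i, (i, j) ∉ F) ∧ σ j = p)).card ≤ 2) ∧
      (∀ x' : Fin k → Fin M → ℝ,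
        (x' = fun i j =>
          if (i, j) ∈ F ∨ ((∀ i', (i', j) ∉ F) ∧ σ j = i) then 1 else 0) →
        ((∀ i j, 0 ≤ x' i j) ∧ (∀ j, ∑ i, x' i j = 1) ∧
          (∀ i, ∑ j, x' i j ≤ (m i : ℝ)) ∧
          (∀ p, ∑ j, x' p j * t j ≤
            b p + ∑ j ∈ Finset.univ.filter
              (fun j : Fin M => (∀ i, (i, j) ∉ F) ∧ σ j = p), t j))) := by
  classical
  subst hS
  obtain ⟨x, hx0, hx1, hxm, hxb, hxF⟩ := hne
  -- the assignment
  have hcard : Fintype.card {j : Fin M // ∀ i, (i, j) ∉ F} ≤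
      Fintype.card ({i : Fin k // c i < m i} × Fin 2) := by
    rw [Fintype.card_prod, Fintype.card_subtype, Fintype.card_subtype, Fintype.card_fin]
    omega
  obtain ⟨e⟩ := Function.Embedding.nonempty_of_card_le hcard
  let σ : Fin M → Fin k := fun j =>
    if h : ∀ i, (i, j) ∉ F then ((e ⟨j, h⟩).1 : Fin k) else ⟨0, hk⟩
  have hσ : ∀ j (h : ∀ i, (i, j) ∉ F), σ j = ((e ⟨j, h⟩).1 : Fin k) := by
    intro j h
    simp only [σ]
    rw [dif_pos h]
  have h1 : ∀ j, (∀ i, (i, j) ∉ F) → c (σ j) < m (σ j) := by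
    intro j h
    rw [hσ j h]
    exact (e ⟨j, h⟩).1.2
  have h2 : ∀ p, (Finset.univ.filter
      (fun j : Fin M => (∀ i, (i, j) ∉ F) ∧ σ j = p)).card ≤ 2 := by
    intro p
    have := Finset.card_le_card_of_injOn
      (s := Finset.univ.filter (fun j : Fin M => (∀ i, (i, j) ∉ F) ∧ σ j = p))
      (t := (Finset.univ : Finset (Fin 2)))
      (fun j => if h : ∀ i, (i, j) ∉ F then (e ⟨j, h⟩).2 else 0)
      (fun _ _ => Finset.mem_coe.2 (Finset.mem_univ _)) (by
        intro a ha a' ha' haa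
        have ha := (Finset.mem_filter.1 (Finset.mem_coe.1 ha)).2
        have ha' := (Finset.mem_filter.1 (Finset.mem_coe.1 ha')).2
        obtain ⟨fa, sa⟩ := ha
        obtain ⟨fb, sb⟩ := ha'
        simp only [] at haa
        rw [dif_pos fa, dif_pos fb] at haa
        rw [hσ _ fa] at sa
        rw [hσ _ fb] at sb
        have : e ⟨a, fa⟩ = e ⟨a', fb⟩ :=
          Prod.ext (Subtype.ext (sa.trans sb.symm)) haa
        exact congrArg Subtype.val (e.injective this))
    simpa using this
  refine ⟨σ, h1, h2, ?_⟩
  intro x' hx'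
  have hsplit : ∀ i j, x' i j = (if (i, j) ∈ F then (1 : ℝ) else 0) +
      (if (∀ i', (i', j) ∉ F) ∧ σ j = i then 1 else 0) := by
    intro i j
    subst hx'
    by_cases hf : (i, j) ∈ F
    · have : ¬ ((∀ i', (i', j) ∉ F) ∧ σ j = i) := fun h => h.1 i hf
      simp only [hf, this, if_true, if_false, true_or, add_zero]
    · simp only [hf, if_false, false_or, zero_add]
  have hFx : ∀ i j, (if (i, j) ∈ F then (1 : ℝ) else 0) ≤ x i j := by
    intro i j
    split_ifs with h
    · exact (hxF _ h).ge
    · exact hx0 i j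
  have hcsum : ∀ i, ∑ j, (if (i, j) ∈ F then (1 : ℝ) else 0) = c i := by
    intro i
    rw [Finset.sum_boole, hc]
    congr 1
    apply Finset.card_bij (fun j _ => (i, j))
    · intro j hj
      simpa using hj
    · intro a _ a' _ h
      exact (Prod.mk.inj h).2
    · rintro ⟨i', j⟩ h
      obtain ⟨h, rfl⟩ := Finset.mem_filter.1 h
      exact ⟨j, by simpa using h, rfl⟩
  have hcm : ∀ i, c i ≤ m i := by
    intro i
    have : (c i : ℝ) ≤ m i := by
      rw [← hcsum i]
      exact (Finset.sum_le_sum fun j _ => hFx i j).trans (hxm i)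
    exact_mod_cast this
  refine ⟨?_, ?_, ?_, ?_⟩
  · intro i j
    rw [hsplit]
    positivity
  · intro j
    by_cases hf : ∀ i', (i', j) ∉ F
    · rw [Finset.sum_eq_single (σ j)]
      · rw [hsplit, if_neg (hf _), if_pos ⟨hf, rfl⟩, zero_add]
      · intro i _ hi
        rw [hsplit, if_neg (hf _), if_neg (fun h => hi h.2.symm), zero_add]
      · intro h
        exact absurd (Finset.mem_univ _) h
    · have hf' := hf
      push Not at hf'
      obtain ⟨i₀, hi₀⟩ := hf'
      rw [Finset.sum_eq_single i₀]
      · rw [hsplit, if_pos hi₀, if_neg (fun h => hf h.1), add_zero]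
      · intro i _ hi
        rw [hsplit, if_neg (fun h => hi (hF _ _ _ h hi₀)), if_neg (fun h => hf h.1), zero_add]
      · intro h
        exact absurd (Finset.mem_univ _) h
  · intro i
    simp only [hsplit]
    rw [Finset.sum_add_distrib, hcsum, Finset.sum_boole]
    have key : c i + (Finset.univ.filter
        (fun j : Fin M => (∀ i, (i, j) ∉ F) ∧ σ j = i)).card ≤ m i := by
      by_cases hi : c i < m i
      · have := hcap i hi
        have := h2 i
        omega
      · have : (Finset.univ.filter
            (fun j : Fin M => (∀ i, (i, j) ∉ F) ∧ σ j = i)) = ∅ := by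
          rw [Finset.filter_eq_empty_iff]
          rintro j _ ⟨hf, rfl⟩
          exact hi (h1 j hf)
        rw [this]
        simpa using hcm i
    exact_mod_cast key
  · intro p
    simp only [hsplit, add_mul]
    rw [Finset.sum_add_distrib, Finset.sum_filter]
    apply add_le_add
    · exact (Finset.sum_le_sum fun j _ =>
        mul_le_mul_of_nonneg_right (hFx p j) (ht j)).trans (hxb p)
    · apply le_of_eq
      apply Finset.sum_congr rfl
      intro j _
      rw [ite_mul, one_mul, zero_mul]
end

section
/- Let k ≥ 1 machines have positive integer capacities m_1, …, m_k, and let M ≥ 1 jobs have nonnegative real processing times t_1, …, t_M, with M ≤ ∑_i m_i. Let c* be the infimum, over all fractional schedules x, of the maximum load max_i ∑_j (x i j) * t_j, and let T = max_j t_j. Then there exists an integral schedule f : Fin M → Fin k (each machine i receives at most m_i jobs) whose makespan max_i ∑_{j : f(j) = i} t_j is at most c* + 2T. -/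
/-- Clamp of `u - s` to the unit interval. -/
noncomputable def smccPhi (s : ℕ) (u : ℝ) : ℝ := min (max (u - s) 0) 1

lemma smccPhi_mono (s : ℕ) : Monotone (smccPhi s) := by
  intro a b h
  unfold smccPhi
  gcongr

lemma smccPhi_sum (n : ℕ) (u : ℝ) (hu : 0 ≤ u) :
    ∑ s ∈ Finset.range n, smccPhi s u = min u n := by
  induction n with
  | zero => simp [hu]
  | succ n ih =>
    rw [Finset.sum_range_succ, ih]
    unfold smccPhi
    push_cast
    rcases le_total u n with h | h
    · rw [min_eq_left h, max_eq_right (by linarith), min_eq_left (by linarith),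
        min_eq_left (by linarith)]
      ring
    · rw [min_eq_right h, max_eq_left (by linarith)]
      rcases le_total u (n + 1) with h' | h'
      · rw [min_eq_left (by linarith), min_eq_left h']; ring
      · rw [min_eq_right (by linarith), min_eq_right h']

/-- Prefix mass. -/
noncomputable def smccC {M : ℕ} (z : Fin M → ℝ) (n : ℕ) : ℝ :=
  ∑ j ∈ Finset.univ.filter (fun j : Fin M => j.val < n), z j

lemma smccC_succ {M : ℕ} (z : Fin M → ℝ) (j : Fin M) :
    smccC z (j.val + 1) = smccC z j.val + z j := by
  unfold smccC
  have : (Finset.univ.filter (fun a : Fin M => a.val < j.val + 1))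
      = insert j (Finset.univ.filter (fun a : Fin M => a.val < j.val)) := by
    ext a
    simp only [Finset.mem_filter, Finset.mem_univ, true_and, Finset.mem_insert, Fin.ext_iff]
    omega
  rw [this, Finset.sum_insert (by simp)]
  ring

lemma smccC_mono {M : ℕ} (z : Fin M → ℝ) (hz : ∀ j, 0 ≤ z j) : Monotone (smccC z) := by
  intro a b h
  unfold smccC
  apply Finset.sum_le_sum_of_subset_of_nonneg
  · intro j hj
    simp only [Finset.mem_filter, Finset.mem_univ, true_and] at hj ⊢
    omega
  · intro j _ _
    exact hz j

lemma smccC_zero {M : ℕ} (z : Fin M → ℝ) : smccC z 0 = 0 := by simp [smccC]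

lemma smccC_top {M : ℕ} (z : Fin M → ℝ) : smccC z M = ∑ j, z j := by simp [smccC]

lemma smccC_nonneg {M : ℕ} (z : Fin M → ℝ) (hz : ∀ j, 0 ≤ z j) (n : ℕ) : 0 ≤ smccC z n :=
  Finset.sum_nonneg (fun j _ => hz j)

/-- Mass of job `j` in slot `s`. -/
noncomputable def smccY {M : ℕ} (z : Fin M → ℝ) (s : ℕ) (j : Fin M) : ℝ :=
  smccPhi s (smccC z (j.val + 1)) - smccPhi s (smccC z j.val)

lemma smccY_nonneg {M : ℕ} (z : Fin M → ℝ) (hz : ∀ j, 0 ≤ z j) (s : ℕ) (j : Fin M) :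
    0 ≤ smccY z s j :=
  sub_nonneg.2 (smccPhi_mono s (smccC_mono z hz (Nat.le_succ _)))

lemma smccY_sum_job {M : ℕ} (z : Fin M → ℝ) (s : ℕ) :
    ∑ j, smccY z s j = smccPhi s (∑ j, z j) := by
  unfold smccY
  rw [Fin.sum_univ_eq_sum_range
    (fun n => smccPhi s (smccC z (n + 1)) - smccPhi s (smccC z n)) M,
    Finset.sum_range_sub (fun n => smccPhi s (smccC z n)), smccC_top, smccC_zero]
  have : smccPhi s 0 = 0 := by simp [smccPhi]
  rw [this, sub_zero]

lemma smccY_sum_slot {M : ℕ} (z : Fin M → ℝ) (hz : ∀ j, 0 ≤ z j) (n : ℕ)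
    (hn : ∑ j, z j ≤ n) (j : Fin M) :
    ∑ s ∈ Finset.range n, smccY z s j = z j := by
  unfold smccY
  have h1 : smccC z (j.val + 1) ≤ n :=
    (smccC_mono z hz j.isLt).trans (by rw [smccC_top]; exact hn)
  have h2 : smccC z j.val ≤ n := (smccC_mono z hz (Nat.le_succ _)).trans h1
  rw [Finset.sum_sub_distrib, smccPhi_sum _ _ (smccC_nonneg z hz _),
    smccPhi_sum _ _ (smccC_nonneg z hz _), min_eq_left h1, min_eq_left h2, smccC_succ]
  ring

lemma smccY_pos {M : ℕ} (z : Fin M → ℝ) (hz : ∀ j, 0 ≤ z j) (s : ℕ) (j : Fin M)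
    (h : 0 < smccY z s j) : (s : ℝ) < smccC z (j.val + 1) ∧ smccC z j.val < s + 1 := by
  unfold smccY at h
  constructor
  · by_contra! h'
    have h'' := smccC_mono z hz (Nat.le_succ j.val)
    simp only [Nat.succ_eq_add_one] at h''
    unfold smccPhi at h
    rw [max_eq_right (by linarith), max_eq_right (by linarith)] at h
    simp at h
  · by_contra! h'
    have h'' := smccC_mono z hz (Nat.le_succ j.val)
    simp only [Nat.succ_eq_add_one] at h''
    unfold smccPhi at h
    rw [min_eq_right (le_max_of_le_left (by linarith)),
      min_eq_right (le_max_of_le_left (by linarith))] at h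
    simp at h

lemma smccY_load {M : ℕ} (z : Fin M → ℝ) (hz : ∀ j, 0 ≤ z j) (t : Fin M → ℝ)
    (hanti : Antitone t) (s : ℕ) (j : Fin M) (h : 0 < smccY z (s + 1) j) :
    t j ≤ ∑ a, smccY z s a * t a := by
  have hj := (smccY_pos z hz _ j h).1
  push_cast at hj
  have htot : ∑ a, smccY z s a = 1 := by
    rw [smccY_sum_job]
    have : smccC z (j.val + 1) ≤ ∑ a, z a := by
      rw [← smccC_top]; exact smccC_mono z hz j.isLt
    unfold smccPhi
    exact min_eq_right (le_max_of_le_left (by linarith))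
  calc t j = ∑ a, smccY z s a * t j := by rw [← Finset.sum_mul, htot, one_mul]
    _ ≤ _ := by
      apply Finset.sum_le_sum
      intro a _
      rcases (smccY_nonneg z hz s a).eq_or_lt with h0 | h0
      · simp [← h0]
      · apply mul_le_mul_of_nonneg_left _ h0.le
        apply hanti
        have ha := (smccY_pos z hz s a h0).2
        by_contra! hlt
        have : smccC z (j.val + 1) ≤ smccC z a.val := smccC_mono z hz hlt
        linarith

lemma smcc_round_anti (k M : ℕ) (m : Fin k → ℕ) (t : Fin M → ℝ) (ht : ∀ j, 0 ≤ t j)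
    (hanti : Antitone t) (T : ℝ) (hT : ∀ j, t j ≤ T) (hT0 : 0 ≤ T)
    (x : Fin k → Fin M → ℝ) (hx : ∀ i j, 0 ≤ x i j) (hx1 : ∀ j, ∑ i, x i j = 1)
    (hxm : ∀ i, ∑ j, x i j ≤ (m i : ℝ)) :
    ∃ f : Fin M → Fin k,
      (∀ i, (Finset.univ.filter (fun j => f j = i)).card ≤ m i) ∧
      ∀ i, ∑ j ∈ Finset.univ.filter (fun j => f j = i), t j ≤ T + ∑ j, x i j * t j := by
  classical
  let r : Fin M → Finset (Σ i : Fin k, Fin (m i)) := fun j =>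
    Finset.univ.filter (fun p => 0 < smccY (x p.1) p.2.val j)
  have hall : ∀ S : Finset (Fin M), S.card ≤ (S.biUnion r).card := by
    intro S
    have h1 : ∀ j, ∑ p : (Σ i : Fin k, Fin (m i)), smccY (x p.1) p.2.val j = 1 := by
      intro j
      rw [Fintype.sum_sigma, ← hx1 j]
      apply Finset.sum_congr rfl
      intro i _
      rw [← smccY_sum_slot (x i) (hx i) (m i) (hxm i) j]
      exact Fin.sum_univ_eq_sum_range (fun s => smccY (x i) s j) (m i)
    have h2 : (S.card : ℝ) ≤ ((S.biUnion r).card : ℝ) := by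
      calc (S.card : ℝ) = ∑ j ∈ S, ∑ p : (Σ i : Fin k, Fin (m i)), smccY (x p.1) p.2.val j := by
            simp [h1]
        _ = ∑ j ∈ S, ∑ p ∈ S.biUnion r, smccY (x p.1) p.2.val j := by
            apply Finset.sum_congr rfl
            intro j hj
            symm
            apply Finset.sum_subset (Finset.subset_univ _)
            intro p _ hp
            by_contra hne
            apply hp
            rw [Finset.mem_biUnion]
            refine ⟨j, hj, ?_⟩
            simp only [r, Finset.mem_filter, Finset.mem_univ, true_and]
            exact lt_of_le_of_ne (smccY_nonneg _ (hx _) _ _) (Ne.symm hne)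
        _ = ∑ p ∈ S.biUnion r, ∑ j ∈ S, smccY (x p.1) p.2.val j := Finset.sum_comm
        _ ≤ ∑ p ∈ S.biUnion r, (1 : ℝ) := by
            apply Finset.sum_le_sum
            intro p _
            calc ∑ j ∈ S, smccY (x p.1) p.2.val j ≤ ∑ j, smccY (x p.1) p.2.val j :=
                  Finset.sum_le_sum_of_subset_of_nonneg (Finset.subset_univ _)
                    (fun j _ _ => smccY_nonneg _ (hx _) _ _)
              _ ≤ 1 := by rw [smccY_sum_job]; exact min_le_right _ _
        _ = _ := by simp
    exact_mod_cast h2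
  obtain ⟨g, hg, hgr⟩ := (Finset.all_card_le_biUnion_card_iff_exists_injective r).1 hall
  have hpos : ∀ j, 0 < smccY (x (g j).1) (g j).2.val j := by
    intro j
    have := hgr j
    simpa [r] using this
  have hinj : ∀ i, Set.InjOn (fun j => (g j).2.val)
      (Finset.univ.filter (fun j => (g j).1 = i) : Finset (Fin M)) := by
    intro i a ha b hb hab
    simp only [Finset.coe_filter, Finset.mem_univ, true_and, Set.mem_ofPred_eq] at ha hb
    apply hg
    apply Sigma.ext (ha.trans hb.symm)
    have hm' : m (g a).1 = m (g b).1 := by rw [ha, hb]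
    exact (Fin.heq_ext_iff hm').2 hab
  have hsub : ∀ i, (Finset.univ.filter (fun j => (g j).1 = i)).image (fun j => (g j).2.val)
      ⊆ Finset.range (m i) := by
    intro i s hs
    rw [Finset.mem_image] at hs
    obtain ⟨j, hj, rfl⟩ := hs
    simp only [Finset.mem_filter, Finset.mem_univ, true_and] at hj
    rw [Finset.mem_range, ← hj]
    exact (g j).2.isLt
  refine ⟨fun j => (g j).1, ?_, ?_⟩
  · intro i
    have := Finset.card_le_card (hsub i)
    rwa [Finset.card_image_of_injOn (hinj i), Finset.card_range] at this
  · intro i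
    let L : ℕ → ℝ := fun s => ∑ a, smccY (x i) s a * t a
    have hL : ∀ s, 0 ≤ L s := fun s =>
      Finset.sum_nonneg (fun a _ => mul_nonneg (smccY_nonneg _ (hx i) _ _) (ht a))
    let w : ℕ → ℝ := fun s => Nat.casesOn s T L
    have hw : ∀ s, 0 ≤ w s := by
      intro s
      cases s with
      | zero => exact hT0
      | succ s => exact hL s
    have hLs : ∑ s ∈ Finset.range (m i), L s = ∑ j, x i j * t j := by
      simp only [L]
      rw [Finset.sum_comm]
      apply Finset.sum_congr rfl
      intro j _
      rw [← Finset.sum_mul, smccY_sum_slot (x i) (hx i) (m i) (hxm i) j]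
    calc ∑ j ∈ Finset.univ.filter (fun j => (g j).1 = i), t j
        ≤ ∑ j ∈ Finset.univ.filter (fun j => (g j).1 = i), w (g j).2.val := by
          apply Finset.sum_le_sum
          intro j hj
          simp only [Finset.mem_filter, Finset.mem_univ, true_and] at hj
          have hp := hpos j
          rcases hs : (g j).2.val with _ | s
          · exact hT j
          · rw [hs, hj] at hp
            exact smccY_load (x i) (hx i) t hanti s j hp
      _ = ∑ s ∈ (Finset.univ.filter (fun j => (g j).1 = i)).image (fun j => (g j).2.val), w s :=
          (Finset.sum_image (hinj i)).symm
      _ ≤ ∑ s ∈ Finset.range (m i), w s :=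
          Finset.sum_le_sum_of_subset_of_nonneg (hsub i) (fun s _ _ => hw s)
      _ ≤ ∑ s ∈ Finset.range (m i + 1), w s := by
          rw [Finset.sum_range_succ]; linarith [hw (m i)]
      _ = T + ∑ j, x i j * t j := by
          rw [Finset.sum_range_succ', ← hLs, add_comm]
          rfl

lemma smcc_round (k M : ℕ) (m : Fin k → ℕ) (t : Fin M → ℝ) (ht : ∀ j, 0 ≤ t j)
    (T : ℝ) (hT : ∀ j, t j ≤ T) (hT0 : 0 ≤ T)
    (x : Fin k → Fin M → ℝ) (hx : ∀ i j, 0 ≤ x i j) (hx1 : ∀ j, ∑ i, x i j = 1)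
    (hxm : ∀ i, ∑ j, x i j ≤ (m i : ℝ)) :
    ∃ f : Fin M → Fin k,
      (∀ i, (Finset.univ.filter (fun j => f j = i)).card ≤ m i) ∧
      ∀ i, ∑ j ∈ Finset.univ.filter (fun j => f j = i), t j ≤ T + ∑ j, x i j * t j := by
  let σ := Tuple.sort (fun j => - t j)
  have hσ : Antitone (t ∘ σ) := by
    intro a b hab
    have := Tuple.monotone_sort (fun j => - t j) hab
    simp only [Function.comp] at this ⊢
    exact neg_le_neg_iff.1 this
  obtain ⟨f, h1, h2⟩ := smcc_round_anti k M m (t ∘ σ) (fun j => ht _) hσ T (fun j => hT _) hT0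
    (fun i j => x i (σ j)) (fun i j => hx _ _) (fun j => hx1 _)
    (fun i => by rw [Equiv.sum_comp σ (x i)]; exact hxm i)
  refine ⟨f ∘ σ.symm, fun i => ?_, fun i => ?_⟩
  · refine le_trans (le_of_eq ?_) (h1 i)
    rw [Finset.card_filter, Finset.card_filter, ← Equiv.sum_comp σ]
    simp
  · have h := h2 i
    rw [Finset.sum_filter] at h ⊢
    rw [← Equiv.sum_comp σ, ← Equiv.sum_comp σ (fun j => x i j * t j)]
    simpa using h

/-- Quantitative guarantee of the iterative rounding algorithm: there is an
integral schedule whose makespan is at most the optimal fractional makespan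
`c*` plus twice the maximum job length `T`. -/
theorem smcc_ira_additive_guarantee
    (k M : ℕ) (hk : 1 ≤ k) (hM : 1 ≤ M)
    (m : Fin k → ℕ) (hm : ∀ i, 0 < m i)
    (t : Fin M → ℝ) (ht : ∀ j, 0 ≤ t j)
    (hMm : M ≤ ∑ i, m i)
    (cstar T : ℝ)
    (hc : cstar = sInf {c : ℝ | ∃ x : Fin k → Fin M → ℝ,
        (∀ i j, 0 ≤ x i j) ∧ (∀ j, ∑ i, x i j = 1) ∧
        (∀ i, ∑ j, x i j ≤ (m i : ℝ)) ∧
        c = ⨆ i, ∑ j, x i j * t j})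
    (hT : T = ⨆ j, t j) :
    ∃ f : Fin M → Fin k,
      (∀ i, (Finset.univ.filter (fun j => f j = i)).card ≤ m i) ∧
      (⨆ i, ∑ j ∈ Finset.univ.filter (fun j => f j = i), t j) ≤ cstar + 2 * T := by
  classical
  have hTb : ∀ j, t j ≤ T := fun j => by
    rw [hT]; exact le_ciSup (Set.finite_range t).bddAbove j
  have hT0 : 0 ≤ T := (ht ⟨0, hM⟩).trans (hTb _)
  have : Nonempty (Fin k) := ⟨⟨0, hk⟩⟩
  have hspos : (0 : ℝ) < ∑ i, (m i : ℝ) := by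
    apply Finset.sum_pos
    · intro i _; exact_mod_cast hm i
    · exact Finset.univ_nonempty
  have hMm' : (M : ℝ) ≤ ∑ i, (m i : ℝ) := by exact_mod_cast hMm
  set A := {c : ℝ | ∃ x : Fin k → Fin M → ℝ,
        (∀ i j, 0 ≤ x i j) ∧ (∀ j, ∑ i, x i j = 1) ∧
        (∀ i, ∑ j, x i j ≤ (m i : ℝ)) ∧
        c = ⨆ i, ∑ j, x i j * t j} with hA
  have hround : ∀ c ∈ A, ∃ f : Fin M → Fin k,
      (∀ i, (Finset.univ.filter (fun j => f j = i)).card ≤ m i) ∧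
      (⨆ i, ∑ j ∈ Finset.univ.filter (fun j => f j = i), t j) ≤ c + T := by
    rintro c ⟨x, hx, hx1, hxm, rfl⟩
    obtain ⟨f, h1, h2⟩ := smcc_round k M m t ht T hTb hT0 x hx hx1 hxm
    refine ⟨f, h1, ciSup_le fun i => (h2 i).trans ?_⟩
    have := le_ciSup (Set.finite_range (fun i => ∑ j, x i j * t j)).bddAbove i
    linarith
  have hne : A.Nonempty := by
    refine ⟨_, fun i _ => (m i : ℝ) / ∑ a, (m a : ℝ), ?_, ?_, ?_, rfl⟩
    · intro i j; positivity
    · intro j; rw [← Finset.sum_div, div_self hspos.ne']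
    · intro i
      rw [Finset.sum_const, Finset.card_univ, Fintype.card_fin, nsmul_eq_mul, mul_div_assoc',
        div_le_iff₀ hspos, mul_comm]
      exact mul_le_mul_of_nonneg_left hMm' (Nat.cast_nonneg _)
  let F : Finset (Fin M → Fin k) := Finset.univ.filter
    (fun f => ∀ i, (Finset.univ.filter (fun j => f j = i)).card ≤ m i)
  have hF : F.Nonempty := by
    obtain ⟨c, hcA⟩ := hne
    obtain ⟨f, h1, -⟩ := hround c hcA
    exact ⟨f, by simpa [F] using h1⟩
  obtain ⟨f, hfF, hmin⟩ := Finset.exists_min_image F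
    (fun f => ⨆ i, ∑ j ∈ Finset.univ.filter (fun j => f j = i), t j) hF
  refine ⟨f, by simpa [F] using hfF, ?_⟩
  have : (⨆ i, ∑ j ∈ Finset.univ.filter (fun j => f j = i), t j) - T ≤ cstar := by
    rw [hc]
    apply le_csInf hne
    intro c hcA
    obtain ⟨f', h1, h2⟩ := hround c hcA
    have := hmin f' (by simpa [F] using h1)
    linarith
  linarith
end
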